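/- Suppose Assumption A1 holds (for f(y,d) = y − d). Then for every n ≥ 0, every x ∈ X, and all integers s, s', y, y': (i) if s ≤ s' then v_n(x,s) ≤ v_n(x,s') + K; (ii) if y ≤ y' then G_n(x,y') − G_n(x,y) ≥ L(x,y') − L(x,y) − βK; (iii) if s ≤ s' ≤ s*(x) then v_n(x,s) ≥ v_n(x,s'); and (iv) if y ≤ y' ≤ s*(x) then G_n(x,y') − G_n(x,y) ≤ L(x,y') − L(x,y) ≤ 0. -/

import Mathlib

open Finset

noncomputable section

open scoped Classical

namespace InvCtrl

variable {N M : ℕ} {Z : Type*}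

/-- Membership in the belief space `X ⊆ ℝ^N`. -/
def memX (N : ℕ) (x : Fin N → ℝ) : Prop :=
  (∀ i, 0 ≤ x i) ∧ ∑ i, x i = 1

variable [Fintype Z]

/-- `σ(d_k, z, x) = x ⬝ P(d_k, z) ⬝ 𝟙`. -/
def sigz (P : Fin M → Z → Matrix (Fin N) (Fin N) ℝ) (k : Fin M) (z : Z) (x : Fin N → ℝ) : ℝ :=
  ∑ i, x i * ∑ j, P k z i j

/-- `σ(d_k, x) = ∑_z σ(d_k, z, x)`. -/
def sig (P : Fin M → Z → Matrix (Fin N) (Fin N) ℝ) (k : Fin M) (x : Fin N → ℝ) : ℝ :=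
  ∑ z, sigz P k z x

/-- Posterior belief `λ(d_k, z, x) = x P(d_k, z) / σ(d_k, z, x)` (componentwise). -/
def lam (P : Fin M → Z → Matrix (Fin N) (Fin N) ℝ) (k : Fin M) (z : Z) (x : Fin N → ℝ) :
    Fin N → ℝ :=
  fun j => (∑ i, x i * P k z i j) / sigz P k z x

/-- Single-period cost `c(y, d) = p·(d − y)⁺ + h·(y − d)⁺`. -/
def cst (p hc y dd : ℝ) : ℝ := p * max (dd - y) 0 + hc * max (y - dd) 0

/-- Expected single-period cost `L(x, y) = ∑_k σ(d_k, x) c(y, d_k)`. -/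
def Lf (P : Fin M → Z → Matrix (Fin N) (Fin N) ℝ) (d : Fin M → ℤ) (p hc : ℝ)
    (x : Fin N → ℝ) (y : ℝ) : ℝ :=
  ∑ k, sig P k x * cst p hc y (d k : ℝ)

/-- `s*(x)`: the smallest element of `{d_1, …, d_M}` at which `m ↦ L(x, d_m)` is minimized. -/
def sStar (P : Fin M → Z → Matrix (Fin N) (Fin N) ℝ) (d : Fin M → ℤ) (p hc : ℝ)
    (x : Fin N → ℝ) : ℤ :=
  sInf {t : ℤ | ∃ m : Fin M, t = d m ∧ ∀ k : Fin M, Lf P d p hc x (d m : ℝ) ≤ Lf P d p hc x (d k : ℝ)}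

/-- First-order stochastic dominance `x ⪯ x'`. -/
def sdom (x x' : Fin N → ℝ) : Prop :=
  ∀ n : Fin N, ∑ i ∈ univ.filter (fun i => n ≤ i), x i ≤ ∑ i ∈ univ.filter (fun i => n ≤ i), x' i

/-- The `i`-th standard unit vector in `ℝ^N`. -/
def eV (N : ℕ) (i : Fin N) : Fin N → ℝ := fun j => if j = i then 1 else 0

/-- Assumption A3. -/
def A3 (P : Fin M → Z → Matrix (Fin N) (Fin N) ℝ) : Prop :=
  ∀ i i' : Fin N, i ≤ i' → ∀ m : Fin M,
    ∑ k ∈ univ.filter (fun k : Fin M => m ≤ k), ∑ j, ∑ z, P k z i j ≤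
      ∑ k ∈ univ.filter (fun k : Fin M => m ≤ k), ∑ j, ∑ z, P k z i' j

/-- `A_m(x) = h ∑_{k=1}^m σ(d_k,x) − p ∑_{k=m+1}^M σ(d_k,x)` (for `m = 0, …, M`). -/
def Am (P : Fin M → Z → Matrix (Fin N) (Fin N) ℝ) (p hc : ℝ) (m : ℕ) (x : Fin N → ℝ) : ℝ :=
  hc * ∑ k ∈ univ.filter (fun k : Fin M => (k : ℕ) < m), sig P k x
    - p * ∑ k ∈ univ.filter (fun k : Fin M => m ≤ (k : ℕ)), sig P k x

/-- `B_m(x) = p ∑_{k=m+1}^M d_k σ(d_k,x) − h ∑_{k=1}^m d_k σ(d_k,x)` (for `m = 0, …, M`). -/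
def Bm (P : Fin M → Z → Matrix (Fin N) (Fin N) ℝ) (d : Fin M → ℤ) (p hc : ℝ) (m : ℕ)
    (x : Fin N → ℝ) : ℝ :=
  p * ∑ k ∈ univ.filter (fun k : Fin M => m ≤ (k : ℕ)), (d k : ℝ) * sig P k x
    - hc * ∑ k ∈ univ.filter (fun k : Fin M => (k : ℕ) < m), (d k : ℝ) * sig P k x

/-- Value iteration with reorder cost `K`: `v_0 = 0` and
`v_{n+1}(x,s) = inf_{y ≥ s, y ∈ ℤ} [ K ξ(y−s) + L(x,y) + β ∑_{(d_k,z) : σ ≠ 0}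
σ(d_k,z,x) v_n(λ(d_k,z,x), y − d_k) ]`, `ξ(0) = 0`, `ξ(t) = 1` for `t ≠ 0`. -/
def vIterK (P : Fin M → Z → Matrix (Fin N) (Fin N) ℝ) (d : Fin M → ℤ) (p hc β K : ℝ) :
    ℕ → (Fin N → ℝ) → ℤ → ℝ
  | 0, _, _ => 0
  | n + 1, x, s =>
    sInf {r : ℝ | ∃ y : ℤ, s ≤ y ∧
      r = K * (if y = s then 0 else 1) +
        (Lf P d p hc x (y : ℝ) + β * ∑ k, ∑ z,
          (if sigz P k z x = 0 then 0
           else sigz P k z x * vIterK P d p hc β K n (lam P k z x) (y - d k)))}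

/-- `G_n(x,y) = L(x,y) + β ∑_{(d_k,z) : σ ≠ 0} σ(d_k,z,x) v_n(λ(d_k,z,x), y − d_k)`. -/
def GKfun (P : Fin M → Z → Matrix (Fin N) (Fin N) ℝ) (d : Fin M → ℤ) (p hc β K : ℝ)
    (n : ℕ) (x : Fin N → ℝ) (y : ℤ) : ℝ :=
  Lf P d p hc x (y : ℝ) + β * ∑ k, ∑ z,
    (if sigz P k z x = 0 then 0
     else sigz P k z x * vIterK P d p hc β K n (lam P k z x) (y - d k))

section helpers

variable {P : Fin M → Z → Matrix (Fin N) (Fin N) ℝ} {d : Fin M → ℤ} {p hc β K : ℝ}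

lemma sigz_nonneg (hPnn : ∀ k z i j, 0 ≤ P k z i j) {x : Fin N → ℝ} (hx : memX N x)
    (k : Fin M) (z : Z) : 0 ≤ sigz P k z x :=
  Finset.sum_nonneg fun i _ => mul_nonneg (hx.1 i) (Finset.sum_nonneg fun j _ => hPnn k z i j)

lemma sig_nonneg (hPnn : ∀ k z i j, 0 ≤ P k z i j) {x : Fin N → ℝ} (hx : memX N x)
    (k : Fin M) : 0 ≤ sig P k x :=
  Finset.sum_nonneg fun z _ => sigz_nonneg hPnn hx k z

lemma sum_sigz (hPst : ∀ i : Fin N, ∑ k : Fin M, ∑ z : Z, ∑ j : Fin N, P k z i j = 1)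
    {x : Fin N → ℝ} (hx : memX N x) : ∑ k, ∑ z, sigz P k z x = 1 := by
  have h1 : ∑ k, ∑ z, sigz P k z x = ∑ i, x i * ∑ k : Fin M, ∑ z : Z, ∑ j : Fin N, P k z i j := by
    simp only [sigz]
    rw [Finset.sum_congr rfl (fun k _ => Finset.sum_comm), Finset.sum_comm]
    refine Finset.sum_congr rfl fun i _ => ?_
    rw [Finset.mul_sum]
    refine Finset.sum_congr rfl fun k _ => ?_
    rw [Finset.mul_sum]
  rw [h1]
  simp only [hPst, mul_one]
  exact hx.2

lemma lam_mem (hPnn : ∀ k z i j, 0 ≤ P k z i j) {x : Fin N → ℝ} (hx : memX N x)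
    {k : Fin M} {z : Z} (h : sigz P k z x ≠ 0) : memX N (lam P k z x) := by
  refine ⟨fun j => div_nonneg (Finset.sum_nonneg fun i _ => mul_nonneg (hx.1 i) (hPnn k z i j))
    (sigz_nonneg hPnn hx k z), ?_⟩
  simp only [lam]
  rw [← Finset.sum_div, Finset.sum_comm]
  have : ∑ i, ∑ j, x i * P k z i j = sigz P k z x := by
    simp only [sigz, Finset.mul_sum]
  rw [this, div_self h]

lemma cst_nonneg (hp : 0 < p) (hhc : 0 < hc) (y e : ℝ) : 0 ≤ cst p hc y e := by
  unfold cst; positivity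

lemma cst_mono (hp : 0 < p) {y b e : ℝ} (h1 : y ≤ b) (h2 : b ≤ e) :
    cst p hc b e ≤ cst p hc y e := by
  unfold cst
  rw [max_eq_left (by linarith), max_eq_right (by linarith), max_eq_left (by linarith),
    max_eq_right (by linarith)]
  nlinarith

lemma cst_affine {a y b e : ℝ} (h1 : a ≤ y) (h2 : y ≤ b) (h : e ≤ a ∨ b ≤ e) :
    (b - a) * cst p hc y e = (b - y) * cst p hc a e + (y - a) * cst p hc b e := by
  unfold cst
  rcases h with h | h
  · rw [max_eq_right (by linarith), max_eq_left (by linarith), max_eq_right (by linarith),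
      max_eq_left (by linarith), max_eq_right (by linarith), max_eq_left (by linarith)]
    ring
  · rw [max_eq_left (by linarith), max_eq_right (by linarith), max_eq_left (by linarith),
      max_eq_right (by linarith), max_eq_left (by linarith), max_eq_right (by linarith)]
    ring

lemma max_convex {a y b e : ℝ} (h1 : a ≤ y) (h2 : y ≤ b) :
    (b - a) * max (y - e) 0 ≤ (b - y) * max (a - e) 0 + (y - a) * max (b - e) 0 := by
  have e1 := mul_le_mul_of_nonneg_left (le_max_left (a - e) 0) (sub_nonneg.2 h2)
  have e2 := mul_le_mul_of_nonneg_left (le_max_left (b - e) 0) (sub_nonneg.2 h1)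
  have e3 := mul_nonneg (sub_nonneg.2 h2) (le_max_right (a - e) 0)
  have e4 := mul_nonneg (sub_nonneg.2 h1) (le_max_right (b - e) 0)
  rcases max_cases (y - e) 0 with ⟨h, _⟩ | ⟨h, _⟩ <;> rw [h] <;> nlinarith

lemma cst_convex (hp : 0 < p) (hhc : 0 < hc) {a y b e : ℝ} (h1 : a ≤ y) (h2 : y ≤ b) :
    (b - a) * cst p hc y e ≤ (b - y) * cst p hc a e + (y - a) * cst p hc b e := by
  have e1 := mul_le_mul_of_nonneg_left (max_convex (e := e) h1 h2) hhc.le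
  have e2 := mul_le_mul_of_nonneg_left
    (max_convex (e := -e) (neg_le_neg h2) (neg_le_neg h1)) hp.le
  have r : ∀ t : ℝ, -t - -e = e - t := fun t => by ring
  simp only [r] at e2
  unfold cst
  nlinarith

lemma Lf_nonneg (hPnn : ∀ k z i j, 0 ≤ P k z i j) (hp : 0 < p) (hhc : 0 < hc)
    {x : Fin N → ℝ} (hx : memX N x) (y : ℝ) : 0 ≤ Lf P d p hc x y :=
  Finset.sum_nonneg fun k _ => mul_nonneg (sig_nonneg hPnn hx k) (cst_nonneg hp hhc _ _)

lemma Lf_convex (hPnn : ∀ k z i j, 0 ≤ P k z i j) (hp : 0 < p) (hhc : 0 < hc)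
    {x : Fin N → ℝ} (hx : memX N x) {a y b : ℝ} (h1 : a ≤ y) (h2 : y ≤ b) :
    (b - a) * Lf P d p hc x y ≤ (b - y) * Lf P d p hc x a + (y - a) * Lf P d p hc x b := by
  simp only [Lf, Finset.mul_sum]
  rw [← Finset.sum_add_distrib]
  refine Finset.sum_le_sum fun k _ => ?_
  have := mul_le_mul_of_nonneg_left (cst_convex (e := (d k : ℝ)) hp hhc h1 h2)
    (sig_nonneg hPnn hx k)
  linarith

lemma Lf_affine {x : Fin N → ℝ} {a y b : ℝ} (h1 : a ≤ y) (h2 : y ≤ b)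
    (h : ∀ k, (d k : ℝ) ≤ a ∨ b ≤ (d k : ℝ)) :
    (b - a) * Lf P d p hc x y = (b - y) * Lf P d p hc x a + (y - a) * Lf P d p hc x b := by
  simp only [Lf, Finset.mul_sum]
  rw [← Finset.sum_add_distrib]
  refine Finset.sum_congr rfl fun k _ => ?_
  have := cst_affine (p := p) (hc := hc) h1 h2 (h k)
  linear_combination sig P k x * this

lemma sStar_spec (hM : 1 ≤ M) (x : Fin N → ℝ) :
    ∃ m : Fin M, sStar P d p hc x = d m ∧
      ∀ k : Fin M, Lf P d p hc x (d m : ℝ) ≤ Lf P d p hc x (d k : ℝ) := by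
  have : Nonempty (Fin M) := ⟨⟨0, hM⟩⟩
  refine Int.csInf_mem (s := {t : ℤ | ∃ m : Fin M, t = d m ∧ ∀ k : Fin M,
    Lf P d p hc x (d m : ℝ) ≤ Lf P d p hc x (d k : ℝ)}) ?_ ?_
  · obtain ⟨m, hm⟩ := Finite.exists_min (fun m : Fin M => Lf P d p hc x (d m : ℝ))
    exact ⟨d m, m, rfl, hm⟩
  · refine ((Set.finite_range d).subset ?_).bddBelow
    rintro t ⟨m, rfl, _⟩
    exact ⟨m, rfl⟩

lemma Lf_star_le (hPnn : ∀ k z i j, 0 ≤ P k z i j) (hp : 0 < p)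
    {x : Fin N → ℝ} (hx : memX N x) (m : Fin M)
    (hm : ∀ k : Fin M, Lf P d p hc x (d m : ℝ) ≤ Lf P d p hc x (d k : ℝ))
    (y : ℤ) (hy : y ≤ d m) : Lf P d p hc x (d m : ℝ) ≤ Lf P d p hc x (y : ℝ) := by
  obtain ⟨kb, hkb, hkb'⟩ := Finset.exists_min_image (univ.filter fun k : Fin M => y ≤ d k) d
    ⟨m, by simp [hy]⟩
  simp only [Finset.mem_filter, Finset.mem_univ, true_and] at hkb hkb'
  by_cases hA : ∃ k, d k < y
  · obtain ⟨k0, hk0⟩ := hA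
    obtain ⟨ka, hka, hka'⟩ := Finset.exists_max_image (univ.filter fun k : Fin M => d k < y) d
      ⟨k0, by simp [hk0]⟩
    simp only [Finset.mem_filter, Finset.mem_univ, true_and] at hka hka'
    have ha : (d ka : ℝ) < y := by exact_mod_cast hka
    have hb : (y : ℝ) ≤ d kb := by exact_mod_cast hkb
    have := Lf_affine (P := P) (d := d) (p := p) (hc := hc) (x := x) ha.le hb (fun k => by
      rcases lt_or_ge (d k) y with h | h
      · left; exact_mod_cast hka' k h
      · right; exact_mod_cast hkb' k h)
    have e1 := mul_le_mul_of_nonneg_left (hm ka) (sub_nonneg.2 hb)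
    have e2 := mul_le_mul_of_nonneg_left (hm kb) (sub_nonneg.2 ha.le)
    have : ((d kb : ℝ) - d ka) * Lf P d p hc x (d m : ℝ)
      ≤ ((d kb : ℝ) - d ka) * Lf P d p hc x (y : ℝ) := by linarith
    exact le_of_mul_le_mul_left this (by linarith)
  · push Not at hA
    refine (hm kb).trans ?_
    refine Finset.sum_le_sum fun k _ => mul_le_mul_of_nonneg_left ?_ (sig_nonneg hPnn hx k)
    exact cst_mono hp (by exact_mod_cast hkb) (by exact_mod_cast hkb' k (hA k))

lemma Lf_anti (hM : 1 ≤ M) (hPnn : ∀ k z i j, 0 ≤ P k z i j) (hp : 0 < p) (hhc : 0 < hc)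
    {x : Fin N → ℝ} (hx : memX N x) (y y' : ℤ) (h1 : y ≤ y') (h2 : y' ≤ sStar P d p hc x) :
    Lf P d p hc x (y' : ℝ) ≤ Lf P d p hc x (y : ℝ) := by
  obtain ⟨m, hs, hm⟩ := sStar_spec (P := P) (d := d) (p := p) (hc := hc) hM x
  rw [hs] at h2
  rcases h1.eq_or_lt with rfl | hlt
  · exact le_rfl
  have h0 := Lf_star_le hPnn hp hx m hm y (h1.trans h2)
  have ha : (y : ℝ) < y' := by exact_mod_cast hlt
  have hb : (y' : ℝ) ≤ d m := by exact_mod_cast h2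
  have hcv := Lf_convex (P := P) (d := d) hPnn hp hhc hx ha.le hb
  have e2 := mul_le_mul_of_nonneg_left h0 (sub_nonneg.2 ha.le)
  have : ((d m : ℝ) - y) * Lf P d p hc x (y' : ℝ)
      ≤ ((d m : ℝ) - y) * Lf P d p hc x (y : ℝ) := by linarith
  exact le_of_mul_le_mul_left this (by linarith)

lemma v_succ (n : ℕ) (x : Fin N → ℝ) (s : ℤ) : vIterK P d p hc β K (n + 1) x s =
    sInf {r : ℝ | ∃ y : ℤ, s ≤ y ∧
      r = K * (if y = s then 0 else 1) + GKfun P d p hc β K n x y} := rfl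

lemma G_nonneg (hPnn : ∀ k z i j, 0 ≤ P k z i j) (hp : 0 < p) (hhc : 0 < hc) (hβ0 : 0 ≤ β)
    (n : ℕ) (hv : ∀ x, memX N x → ∀ s, 0 ≤ vIterK P d p hc β K n x s)
    {x : Fin N → ℝ} (hx : memX N x) (y : ℤ) : 0 ≤ GKfun P d p hc β K n x y := by
  refine add_nonneg (Lf_nonneg hPnn hp hhc hx _) (mul_nonneg hβ0 ?_)
  refine Finset.sum_nonneg fun k _ => Finset.sum_nonneg fun z _ => ?_
  split_ifs with h
  · exact le_rfl
  · exact mul_nonneg (sigz_nonneg hPnn hx k z) (hv _ (lam_mem hPnn hx h) _)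

lemma v_nonneg (hPnn : ∀ k z i j, 0 ≤ P k z i j) (hp : 0 < p) (hhc : 0 < hc) (hβ0 : 0 ≤ β)
    (hK : 0 < K) (n : ℕ) : ∀ x, memX N x → ∀ s, 0 ≤ vIterK P d p hc β K n x s := by
  induction n with
  | zero => intro x _ s; exact le_rfl
  | succ n ih =>
    intro x hx s
    rw [v_succ]
    refine Real.sInf_nonneg ?_
    rintro r ⟨y, _, rfl⟩
    refine add_nonneg ?_ (G_nonneg hPnn hp hhc hβ0 n ih hx y)
    split_ifs <;> simp [hK.le]

lemma v_le (hPnn : ∀ k z i j, 0 ≤ P k z i j) (hp : 0 < p) (hhc : 0 < hc) (hβ0 : 0 ≤ β)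
    (hK : 0 < K) (n : ℕ) {x : Fin N → ℝ} (hx : memX N x) {s y : ℤ} (h : s ≤ y) :
    vIterK P d p hc β K (n + 1) x s ≤
      K * (if y = s then 0 else 1) + GKfun P d p hc β K n x y := by
  rw [v_succ]
  refine csInf_le ⟨0, ?_⟩ ⟨y, h, rfl⟩
  rintro r ⟨y, _, rfl⟩
  refine add_nonneg ?_
    (G_nonneg hPnn hp hhc hβ0 n (v_nonneg hPnn hp hhc hβ0 hK n) hx y)
  split_ifs <;> simp [hK.le]

lemma le_v (n : ℕ) {x : Fin N → ℝ} {s : ℤ} {c : ℝ}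
    (h : ∀ y, s ≤ y → c ≤ K * (if y = s then 0 else 1) + GKfun P d p hc β K n x y) :
    c ≤ vIterK P d p hc β K (n + 1) x s := by
  rw [v_succ]
  refine le_csInf ⟨_, s, le_rfl, rfl⟩ ?_
  rintro r ⟨y, hy, rfl⟩
  exact h y hy

lemma G_lower (hPnn : ∀ k z i j, 0 ≤ P k z i j)
    (hPst : ∀ i : Fin N, ∑ k : Fin M, ∑ z : Z, ∑ j : Fin N, P k z i j = 1) (hβ0 : 0 ≤ β)
    (n : ℕ) (hv : ∀ x, memX N x → ∀ s s' : ℤ, s ≤ s' →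
      vIterK P d p hc β K n x s ≤ vIterK P d p hc β K n x s' + K)
    {x : Fin N → ℝ} (hx : memX N x) (y y' : ℤ) (h : y ≤ y') :
    Lf P d p hc x (y' : ℝ) - Lf P d p hc x (y : ℝ) - β * K ≤
          GKfun P d p hc β K n x y' - GKfun P d p hc β K n x y := by
  have key : (∑ k, ∑ z, (if sigz P k z x = 0 then 0
     else sigz P k z x * vIterK P d p hc β K n (lam P k z x) (y - d k))) ≤
     (∑ k, ∑ z, (if sigz P k z x = 0 then 0
     else sigz P k z x * vIterK P d p hc β K n (lam P k z x) (y' - d k))) + K := by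
    have hKs : K = ∑ k, ∑ z, sigz P k z x * K := by
      simp only [← Finset.sum_mul]
      rw [sum_sigz hPst hx, one_mul]
    conv_rhs => rw [hKs]
    rw [← Finset.sum_add_distrib]
    refine Finset.sum_le_sum fun k _ => ?_
    rw [← Finset.sum_add_distrib]
    refine Finset.sum_le_sum fun z _ => ?_
    split_ifs with h0
    · simp [h0]
    · rw [← mul_add, ← hKs]
      exact mul_le_mul_of_nonneg_left (hv _ (lam_mem hPnn hx h0) _ _ (by omega))
        (sigz_nonneg hPnn hx k z)
  have := mul_le_mul_of_nonneg_left key hβ0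
  unfold GKfun
  linarith

lemma G_upper (hPnn : ∀ k z i j, 0 ≤ P k z i j) (hβ0 : 0 ≤ β)
    (hA1 : ∀ x : Fin N → ℝ, memX N x → ∀ (k : Fin M) (z : Z), sigz P k z x ≠ 0 →
      sStar P d p hc x - d k ≤ sStar P d p hc (lam P k z x))
    (n : ℕ) (hv : ∀ x, memX N x → ∀ s s' : ℤ, s ≤ s' → s' ≤ sStar P d p hc x →
      vIterK P d p hc β K n x s' ≤ vIterK P d p hc β K n x s)
    {x : Fin N → ℝ} (hx : memX N x) (y y' : ℤ) (h : y ≤ y') (h' : y' ≤ sStar P d p hc x) :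
    GKfun P d p hc β K n x y' - GKfun P d p hc β K n x y ≤
      Lf P d p hc x (y' : ℝ) - Lf P d p hc x (y : ℝ) := by
  have key : (∑ k, ∑ z, (if sigz P k z x = 0 then 0
     else sigz P k z x * vIterK P d p hc β K n (lam P k z x) (y' - d k))) ≤
     (∑ k, ∑ z, (if sigz P k z x = 0 then 0
     else sigz P k z x * vIterK P d p hc β K n (lam P k z x) (y - d k))) := by
    refine Finset.sum_le_sum fun k _ => Finset.sum_le_sum fun z _ => ?_
    split_ifs with h0
    · exact le_rfl
    · have := hA1 x hx k z h0
      exact mul_le_mul_of_nonneg_left (hv _ (lam_mem hPnn hx h0) _ _ (by omega) (by omega))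
        (sigz_nonneg hPnn hx k z)
  have := mul_le_mul_of_nonneg_left key hβ0
  unfold GKfun
  linarith

end helpers

/-- Lemma 11: structural inequalities for `v_n` and `G_n` in the
reorder-cost case, under Assumption A1 (for `f(y,d) = y − d`). -/
theorem stmt18 {N M : ℕ} {Z : Type*} [Fintype Z] [Nonempty Z]
    (hN : 1 ≤ N) (hM : 1 ≤ M)
    (d : Fin M → ℤ) (hd : StrictMono d)
    (P : Fin M → Z → Matrix (Fin N) (Fin N) ℝ)
    (hPnn : ∀ k z i j, 0 ≤ P k z i j)
    (hPst : ∀ i : Fin N, ∑ k : Fin M, ∑ z : Z, ∑ j : Fin N, P k z i j = 1)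
    (p hc : ℝ) (hp : 0 < p) (hhc : 0 < hc)
    (K : ℝ) (hK : 0 < K) (β : ℝ) (hβ0 : 0 ≤ β) (hβ1 : β < 1)
    (hA1 : ∀ x : Fin N → ℝ, memX N x → ∀ (k : Fin M) (z : Z), sigz P k z x ≠ 0 →
      sStar P d p hc x - d k ≤ sStar P d p hc (lam P k z x)) :
    ∀ (n : ℕ) (x : Fin N → ℝ), memX N x →
      -- (i)
      (∀ s s' : ℤ, s ≤ s' →
        vIterK P d p hc β K n x s ≤ vIterK P d p hc β K n x s' + K) ∧
      -- (ii)
      (∀ y y' : ℤ, y ≤ y' →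
        Lf P d p hc x (y' : ℝ) - Lf P d p hc x (y : ℝ) - β * K ≤
          GKfun P d p hc β K n x y' - GKfun P d p hc β K n x y) ∧
      -- (iii)
      (∀ s s' : ℤ, s ≤ s' → s' ≤ sStar P d p hc x →
        vIterK P d p hc β K n x s' ≤ vIterK P d p hc β K n x s) ∧
      -- (iv)
      (∀ y y' : ℤ, y ≤ y' → y' ≤ sStar P d p hc x →
        GKfun P d p hc β K n x y' - GKfun P d p hc β K n x y ≤
            Lf P d p hc x (y' : ℝ) - Lf P d p hc x (y : ℝ) ∧
          Lf P d p hc x (y' : ℝ) - Lf P d p hc x (y : ℝ) ≤ 0) := by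
  have main : ∀ n : ℕ, (∀ x, memX N x → ∀ s s' : ℤ, s ≤ s' →
      vIterK P d p hc β K n x s ≤ vIterK P d p hc β K n x s' + K) ∧
      (∀ x, memX N x → ∀ s s' : ℤ, s ≤ s' → s' ≤ sStar P d p hc x →
        vIterK P d p hc β K n x s' ≤ vIterK P d p hc β K n x s) := by
    intro n
    induction n with
    | zero =>
      refine ⟨fun x _ s s' _ => ?_, fun x _ s s' _ _ => le_rfl⟩
      simp only [vIterK]; linarith
    | succ n ih =>
      refine ⟨fun x hx s s' h => ?_, fun x hx s s' h h' => ?_⟩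
      · rw [← sub_le_iff_le_add]
        refine le_v n fun y hy => ?_
        have := v_le (d := d) hPnn hp hhc hβ0 hK n hx (h.trans hy)
        split_ifs at this ⊢ <;> linarith
      · rcases h.eq_or_lt with rfl | hlt
        · exact le_rfl
        refine le_v n fun y hy => ?_
        rcases lt_or_ge y s' with hys | hys
        · have h1 := v_le (d := d) hPnn hp hhc hβ0 hK n hx (le_refl s')
          have h2 := G_upper hPnn hβ0 hA1 n ih.2 hx y s' hys.le h'
          have h3 := Lf_anti (d := d) hM hPnn hp hhc hx y s' hys.le h'
          rw [if_pos rfl] at h1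
          split_ifs <;> linarith
        · have h1 := v_le (d := d) hPnn hp hhc hβ0 hK n hx hys
          rw [if_neg (show ¬ y = s by omega)]
          split_ifs at h1 <;> linarith
  intro n x hx
  refine ⟨(main n).1 x hx, G_lower hPnn hPst hβ0 n (main n).1 hx, (main n).2 x hx,
    fun y y' h h' => ⟨G_upper hPnn hβ0 hA1 n (main n).2 hx y y' h h', ?_⟩⟩
  have := Lf_anti (d := d) hM hPnn hp hhc hx y y' h h'
  linarith

end InvCtrl
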